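/- Let n ≥ 1, let G be a discrete subgroup of PU(1,n), and let (γ_m) be a sequence of pairwise distinct elements of G converging, in the sense of quasi-projective transformations, to a quasi-projective map γ. Then there exist a subsequence of (γ_m) (still denoted (γ_m)) and a quasi-projective map τ such that: (1) (γ_m^{-1}) converges to τ in the sense of quasi-projective transformations; (2) Im(τ) is a single point lying in ∂𝐇ⁿ_ℂ, and Ker(τ) is a complex projective hyperplane meeting the closure of 𝐇ⁿ_ℂ in exactly one point of ∂𝐇ⁿ_ℂ; (3) Im(τ) = Ker(γ) ∩ ∂𝐇ⁿ_ℂ; (4) Im(γ) = Ker(τ) ∩ ∂𝐇ⁿ_ℂ. -/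

import Mathlib

open Filter Topology Matrix

noncomputable section

abbrev Vec (n : ℕ) := Fin (n + 1) → ℂ
abbrev Mat (n : ℕ) := Matrix (Fin (n + 1)) (Fin (n + 1)) ℂ
abbrev Pn (n : ℕ) := Projectivization ℂ (Vec n)

instance (n : ℕ) : TopologicalSpace (Pn n) :=
  inferInstanceAs (TopologicalSpace (Quotient (projectivizationSetoid ℂ (Vec n))))

def herm (n : ℕ) (u v : Vec n) : ℂ :=
  -(u 0 * (starRingEnd ℂ) (v 0)) + ∑ j : Fin n, u j.succ * (starRingEnd ℂ) (v j.succ)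

def Hball (n : ℕ) : Set (Pn n) :=
  {p | ∃ v : Vec n, ∃ hv : v ≠ 0, p = Projectivization.mk ℂ v hv ∧ (herm n v v).re < 0}

def Hbdry (n : ℕ) : Set (Pn n) :=
  {p | ∃ v : Vec n, ∃ hv : v ≠ 0, p = Projectivization.mk ℂ v hv ∧ herm n v v = 0}

abbrev GLn (n : ℕ) := Matrix.GeneralLinearGroup (Fin (n + 1)) ℂ
abbrev PGLn (n : ℕ) := GLn n ⧸ Subgroup.center (GLn n)

lemma glInj {n : ℕ} (A : GLn n) : Function.Injective (Matrix.mulVecLin (A : Mat n)) := by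
  intro x y h
  simp only [Matrix.mulVecLin_apply] at h
  have h2 : ((A⁻¹ : GLn n) : Mat n) *ᵥ ((A : Mat n) *ᵥ x)
      = ((A⁻¹ : GLn n) : Mat n) *ᵥ ((A : Mat n) *ᵥ y) := by rw [h]
  rwa [Matrix.mulVec_mulVec, Matrix.mulVec_mulVec, Units.inv_mul, Matrix.one_mulVec,
    Matrix.one_mulVec] at h2

def actGL {n : ℕ} (A : GLn n) : Pn n → Pn n :=
  Projectivization.map (Matrix.mulVecLin (A : Mat n)) (glInj A)

def act {n : ℕ} (g : PGLn n) : Pn n → Pn n := actGL (Quotient.out g)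

-- part 2 --

/-- The subset `U(1,n)` of `GL(n+1,ℂ)`: matrices preserving the Hermitian form. -/
def unitaryGL (n : ℕ) : Set (GLn n) :=
  {A | ∀ u v : Vec n, herm n ((A : Mat n) *ᵥ u) ((A : Mat n) *ᵥ v) = herm n u v}

/-- `PU(1,n)`, the image of `U(1,n)` in `PGL(n+1,ℂ)`. -/
def PUset (n : ℕ) : Set (PGLn n) := (QuotientGroup.mk : GLn n → PGLn n) '' unitaryGL n

/-- The center of the ball `𝐇ⁿ_ℂ`, namely the image of `(1,0,…,0)`. -/
def basePt (n : ℕ) : Pn n :=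
  Projectivization.mk ℂ (Pi.single 0 1) (by
    intro h
    have := congrFun h 0
    simp [Pi.single_eq_same] at this)

lemma basePt_mem_Hball (n : ℕ) : basePt n ∈ Hball n := by
  refine ⟨Pi.single 0 1, _, rfl, ?_⟩
  have : herm n (Pi.single 0 1) (Pi.single 0 1) = -1 := by
    simp [herm, Pi.single_eq_same, Pi.single_eq_of_ne (Fin.succ_ne_zero _)]
  rw [this]
  norm_num

/-- The set of accumulation points of the orbit `G • x` in `ℙⁿ_ℂ`: limits of
`g_m • x` along sequences of pairwise distinct elements of `G`. -/
def accPts {n : ℕ} (G : Subgroup (PGLn n)) (x : Pn n) : Set (Pn n) :=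
  {z | ∃ g : ℕ → G, Function.Injective g ∧
    Tendsto (fun m => act (g m : PGLn n) x) atTop (𝓝 z)}

/-- The Chen–Greenberg limit set of `G`. -/
def LambdaCG {n : ℕ} (G : Subgroup (PGLn n)) : Set (Pn n) := accPts G (basePt n)

/-- Uniform convergence on `K` of a sequence of self-maps of `ℙⁿ_ℂ` to `F`, expressed
via open neighborhoods of the diagonal.  Since `ℙⁿ_ℂ` is compact Hausdorff, this is
equivalent to uniform convergence on `K` with respect to any metric inducing its
topology. -/
def UnifConvOn {n : ℕ} (f : ℕ → Pn n → Pn n) (F : Pn n → Pn n) (K : Set (Pn n)) : Prop :=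
  ∀ W : Set (Pn n × Pn n), IsOpen W → (∀ y, (y, y) ∈ W) →
    ∀ᶠ m in atTop, ∀ x ∈ K, (F x, f m x) ∈ W

/-- Uniform convergence on all compact subsets of `S`. -/
def UnifConvOnCompacts {n : ℕ} (f : ℕ → Pn n → Pn n) (F : Pn n → Pn n)
    (S : Set (Pn n)) : Prop :=
  ∀ K ⊆ S, IsCompact K → UnifConvOn f F K

/-- The equicontinuity region of a subgroup `G ≤ PGL(n+1,ℂ)`: points having an open
neighborhood `U` on which every sequence in `G` has a subsequence converging uniformly
on compact subsets of `U`. -/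
def eqRegion {n : ℕ} (G : Subgroup (PGLn n)) : Set (Pn n) :=
  {z | ∃ U : Set (Pn n), IsOpen U ∧ z ∈ U ∧
    ∀ g : ℕ → G, ∃ φ : ℕ → ℕ, StrictMono φ ∧ ∃ F : Pn n → Pn n,
      UnifConvOnCompacts (fun m => act (g (φ m) : PGLn n)) F U}

/-- The equicontinuity region of the family of maps `{f m : m ∈ ℕ}`. -/
def eqRegionFam {n : ℕ} (f : ℕ → Pn n → Pn n) : Set (Pn n) :=
  {z | ∃ U : Set (Pn n), IsOpen U ∧ z ∈ U ∧
    ∀ s : ℕ → ℕ, ∃ φ : ℕ → ℕ, StrictMono φ ∧ ∃ F : Pn n → Pn n,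
      UnifConvOnCompacts (fun k => f (s (φ k))) F U}

/-- The projectivization of a linear subspace `W ⊆ ℂ^{n+1}`, as a subset of `ℙⁿ_ℂ`. -/
def projSet {n : ℕ} (W : Submodule ℂ (Vec n)) : Set (Pn n) := {p | p.rep ∈ W}

/-- A complex projective hyperplane: the projectivization of an `n`-dimensional
subspace of `ℂ^{n+1}`. -/
def IsProjHyperplane {n : ℕ} (S : Set (Pn n)) : Prop :=
  ∃ W : Submodule ℂ (Vec n), Module.finrank ℂ W = n ∧ S = projSet W

/-- A complex projective line: the projectivization of a `2`-dimensional subspace. -/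
def IsProjLine {n : ℕ} (S : Set (Pn n)) : Prop :=
  ∃ W : Submodule ℂ (Vec n), Module.finrank ℂ W = 2 ∧ S = projSet W

/-- The kernel in `ℙⁿ_ℂ` of the quasi-projective map induced by the nonzero matrix `M`. -/
def qKer {n : ℕ} (M : Mat n) : Set (Pn n) := projSet (LinearMap.ker (Matrix.mulVecLin M))

/-- The image in `ℙⁿ_ℂ` of the quasi-projective map induced by the nonzero matrix `M`. -/
def qIm {n : ℕ} (M : Mat n) : Set (Pn n) := projSet (LinearMap.range (Matrix.mulVecLin M))

/-- The quasi-projective map `ℙⁿ_ℂ ∖ Ker(M) → ℙⁿ_ℂ` induced by the nonzero matrix `M`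
(extended to all of `ℙⁿ_ℂ` by the identity on `Ker(M)`, where it is irrelevant). -/
def qMap {n : ℕ} (M : Mat n) : Pn n → Pn n := fun p =>
  if h : M *ᵥ p.rep ≠ 0 then Projectivization.mk ℂ (M *ᵥ p.rep) h else p

/-- Convergence of a sequence of transformations of `ℙⁿ_ℂ` to the quasi-projective map
induced by `M`, in the sense of quasi-projective transformations: uniform convergence
on compact subsets of `ℙⁿ_ℂ ∖ Ker(M)`. -/
def QPConv {n : ℕ} (f : ℕ → Pn n → Pn n) (M : Mat n) : Prop :=
  UnifConvOnCompacts f (qMap M) (qKer M)ᶜ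

/-- The special linear group `SL(n+1,ℂ)`. -/
abbrev SLn (n : ℕ) := Matrix.SpecialLinearGroup (Fin (n + 1)) ℂ

/-- The projective special linear group `PSL(n+1,ℂ) = SL(n+1,ℂ)/center`. -/
abbrev PSLn (n : ℕ) := SLn n ⧸ Subgroup.center (SLn n)

/-- The projective transformation induced by an element of `SL(n+1,ℂ)`. -/
def actSL {n : ℕ} (A : SLn n) : Pn n → Pn n := actGL (Matrix.SpecialLinearGroup.toGL A)

/-- The projective transformation induced by an element of `PSL(n+1,ℂ)` (via an
arbitrary representative; all representatives induce the same transformation). -/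
def actPSL {n : ℕ} (g : PSLn n) : Pn n → Pn n := actSL (Quotient.out g)

/-- The projective hyperplane tangent to `∂𝐇ⁿ_ℂ` at `p`: the projectivization of the
Hermitian orthogonal complement of a lift of `p`. -/
def tangentAt {n : ℕ} (p : Pn n) : Set (Pn n) := {q | herm n q.rep p.rep = 0}

end

noncomputable section

/-- The point of `ℙⁿ_ℂ` spanned by `v`, with the junk value `basePt n` at `v = 0`. -/
def lineOf {n : ℕ} (v : Vec n) : Pn n :=
  open Classical in if h : v ≠ 0 then Projectivization.mk ℂ v h else basePt n

lemma lineOf_of_ne {n : ℕ} {v : Vec n} (h : v ≠ 0) : lineOf v = Projectivization.mk ℂ v h := by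
  simp [lineOf, h]

lemma exists_lineOf_eq {n : ℕ} (p : Pn n) : ∃ v : Vec n, v ≠ 0 ∧ lineOf v = p :=
  ⟨p.rep, p.rep_nonzero, by rw [lineOf_of_ne p.rep_nonzero, Projectivization.mk_rep]⟩

lemma lineOf_smul {n : ℕ} {c : ℂ} (hc : c ≠ 0) (v : Vec n) : lineOf (c • v) = lineOf v := by
  by_cases hv : v = 0
  · simp [hv]
  · rw [lineOf_of_ne hv, lineOf_of_ne (smul_ne_zero hc hv), Projectivization.mk_eq_mk_iff']
    exact ⟨c, rfl⟩

lemma lineOf_eq_iff {n : ℕ} {v w : Vec n} (hv : v ≠ 0) (hw : w ≠ 0) :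
    lineOf v = lineOf w ↔ ∃ c : ℂ, c • w = v := by
  rw [lineOf_of_ne hv, lineOf_of_ne hw, Projectivization.mk_eq_mk_iff']

lemma exists_rep_lineOf {n : ℕ} {v : Vec n} (hv : v ≠ 0) :
    ∃ c : ℂ, c ≠ 0 ∧ (lineOf v).rep = c • v := by
  obtain ⟨a, ha⟩ := Projectivization.exists_smul_eq_mk_rep ℂ v hv
  exact ⟨a, a.ne_zero, by rw [lineOf_of_ne hv, ← ha]; rfl⟩

lemma lineOf_mem_projSet {n : ℕ} {v : Vec n} (hv : v ≠ 0) (W : Submodule ℂ (Vec n)) :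
    lineOf v ∈ projSet W ↔ v ∈ W := by
  obtain ⟨c, hc, h⟩ := exists_rep_lineOf hv
  change (lineOf v).rep ∈ W ↔ _
  rw [h, W.smul_mem_iff hc]

lemma lineOf_mem_qKer {n : ℕ} {v : Vec n} (hv : v ≠ 0) (M : Mat n) :
    lineOf v ∈ qKer M ↔ M *ᵥ v = 0 := by
  rw [qKer, lineOf_mem_projSet hv, LinearMap.mem_ker, Matrix.mulVecLin_apply]

lemma qMap_lineOf {n : ℕ} {M : Mat n} {v : Vec n} (h : M *ᵥ v ≠ 0) :
    qMap M (lineOf v) = lineOf (M *ᵥ v) := by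
  have hv : v ≠ 0 := by rintro rfl; simp at h
  obtain ⟨c, hc, hr⟩ := exists_rep_lineOf hv
  have h1 : M *ᵥ (lineOf v).rep = c • (M *ᵥ v) := by rw [hr, Matrix.mulVec_smul]
  have h2 : M *ᵥ (lineOf v).rep ≠ 0 := by rw [h1]; exact smul_ne_zero hc h
  rw [qMap, dif_pos h2, ← lineOf_of_ne h2, h1, lineOf_smul hc]

lemma actGL_lineOf {n : ℕ} (A : GLn n) {v : Vec n} (hv : v ≠ 0) :
    actGL A (lineOf v) = lineOf ((A : Mat n) *ᵥ v) := by
  have h : (A : Mat n) *ᵥ v ≠ 0 := fun h => hv (glInj A (by simpa using h))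
  rw [lineOf_of_ne hv, lineOf_of_ne h]
  rfl

lemma act_mk_lineOf {n : ℕ} (A : GLn n) {v : Vec n} (hv : v ≠ 0) :
    act (QuotientGroup.mk A : PGLn n) (lineOf v) = lineOf ((A : Mat n) *ᵥ v) := by
  have h : A⁻¹ * Quotient.out (QuotientGroup.mk A : PGLn n) ∈ Subgroup.center (GLn n) :=
    QuotientGroup.eq.1 (Quotient.out_eq' (QuotientGroup.mk A : PGLn n)).symm
  set B := Quotient.out (QuotientGroup.mk A : PGLn n) with hB
  obtain ⟨c, hc⟩ := Matrix.GeneralLinearGroup.mem_center_iff_val_mem_range_scalar.1 h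
  have hBA : (B : Mat n) = c • (A : Mat n) := by
    have : (B : Mat n) = (A : Mat n) * ((A⁻¹ * B : GLn n) : Mat n) := by
      rw [← Units.val_mul, mul_inv_cancel_left]
    rw [this, ← hc, Matrix.scalar_apply, ← Matrix.smul_one_eq_diagonal, Matrix.mul_smul, mul_one]
  have hc0 : c ≠ 0 := by
    rintro rfl
    have h0 := (glInj B).ne hv
    simp [hBA] at h0
  rw [act, ← hB, actGL_lineOf B hv, hBA, Matrix.smul_mulVec, lineOf_smul hc0]

lemma mem_Hbdry_lineOf {n : ℕ} {v : Vec n} (hv : v ≠ 0) (h : herm n v v = 0) :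
    lineOf v ∈ Hbdry n :=
  ⟨v, hv, lineOf_of_ne hv, h⟩

lemma continuousAt_lineOf {n : ℕ} {v : Vec n} (hv : v ≠ 0) :
    ContinuousAt (lineOf : Vec n → Pn n) v := by
  have ho : IsOpen {v : Vec n | v ≠ 0} := isOpen_ne
  refine ContinuousOn.continuousAt ?_ (ho.mem_nhds hv)
  rw [continuousOn_iff_continuous_domRestrict]
  have : Set.domRestrict {v : Vec n | v ≠ 0} lineOf
      = (Quotient.mk (projectivizationSetoid ℂ (Vec n)) :) := by
    funext w
    exact lineOf_of_ne w.2
  rw [this]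
  exact continuous_quotient_mk'

lemma continuous_of_lineOf {n : ℕ} {X : Type*} [TopologicalSpace X] {g : Pn n → X}
    (h : ContinuousOn (fun v : Vec n => g (lineOf v)) {v | v ≠ 0}) : Continuous g := by
  rw [continuousOn_iff_continuous_domRestrict] at h
  have : (Set.domRestrict {v : Vec n | v ≠ 0} fun v : Vec n => g (lineOf v))
      = g ∘ (Quotient.mk (projectivizationSetoid ℂ (Vec n)) :) := by
    funext w
    exact congrArg g (lineOf_of_ne w.2)
  rw [this] at h
  exact (isQuotientMap_quot_mk (r := (projectivizationSetoid ℂ (Vec n)).r)).continuous_iff.2 h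

lemma isOpen_image_lineOf {n : ℕ} {U : Set (Vec n)} (hU : IsOpen U) (h0 : ∀ v ∈ U, v ≠ 0) :
    IsOpen (lineOf '' U) := by
  have hV : IsOpen (⋃ c : {c : ℂ // c ≠ 0}, (fun v : Vec n => (c : ℂ) • v) ⁻¹' U) :=
    isOpen_iUnion fun c => hU.preimage (continuous_const_smul _)
  rw [isOpen_iff_continuous_mem] at hV ⊢
  refine continuous_of_lineOf (hV.continuousOn.congr fun v hv => ?_)
  simp only [Set.mem_iUnion, Set.mem_preimage, Subtype.exists, exists_prop, eq_iff_iff]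
  constructor
  · rintro ⟨u, hu, huv⟩
    obtain ⟨c, rfl⟩ := (lineOf_eq_iff (h0 u hu) hv).1 huv
    exact ⟨c, by rintro rfl; exact h0 _ hu (zero_smul _ _), hu⟩
  · rintro ⟨c, hc, hcv⟩
    exact ⟨c • v, hcv, lineOf_smul hc v⟩

lemma nhds_lineOf_le_map {n : ℕ} {v : Vec n} (hv : v ≠ 0) :
    𝓝 (lineOf v) ≤ map lineOf (𝓝 v) := by
  intro S hS
  obtain ⟨U, hUS, hU, hvU⟩ := mem_nhds_iff.1 (inter_mem (mem_map.1 hS) (isOpen_ne.mem_nhds hv))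
  exact mem_of_superset ((isOpen_image_lineOf hU fun u hu => (hUS hu).2).mem_nhds ⟨v, hvU, rfl⟩)
    (Set.image_subset_iff.2 fun u hu => (hUS hu).1)

/-- Continuous functions on `ℙⁿ_ℂ` correspond to scale-invariant continuous functions on the
nonzero vectors. -/
lemma exists_continuous_lift {n : ℕ} (h : Vec n → ℝ) (hcont : ContinuousOn h {v | v ≠ 0})
    (hsmul : ∀ (c : ℂ) (v : Vec n), c ≠ 0 → h (c • v) = h v) :
    ∃ g : Pn n → ℝ, Continuous g ∧ ∀ v : Vec n, v ≠ 0 → g (lineOf v) = h v := by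
  have key : ∀ v : Vec n, v ≠ 0 → h (lineOf v).rep = h v := fun v hv => by
    obtain ⟨c, hc, hr⟩ := exists_rep_lineOf hv
    rw [hr, hsmul c v hc]
  exact ⟨fun p => h p.rep, continuous_of_lineOf (hcont.congr key), key⟩

lemma tendsto_mulVec {n : ℕ} {ι : Type*} {F : Filter ι} {C : ι → Mat n} {B : Mat n}
    {u : ι → Vec n} {v : Vec n} (hC : Tendsto C F (𝓝 B)) (hu : Tendsto u F (𝓝 v)) :
    Tendsto (fun i => C i *ᵥ u i) F (𝓝 (B *ᵥ v)) := by
  refine tendsto_pi_nhds.2 fun i => ?_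
  simp only [Matrix.mulVec, dotProduct]
  refine tendsto_finsetSum _ fun j _ => ?_
  have hij : Tendsto (fun k => C k i j) F (𝓝 (B i j)) :=
    ((continuous_id.matrix_elem i j).tendsto B).comp hC
  exact hij.mul (tendsto_pi_nhds.1 hu j)

lemma qpConv_of_tendsto {n : ℕ} {f : ℕ → Pn n → Pn n} {C : ℕ → Mat n} {N : Mat n}
    (hf : ∀ m v, v ≠ 0 → f m (lineOf v) = lineOf (C m *ᵥ v))
    (hC : Tendsto C atTop (𝓝 N)) : QPConv f N := by
  intro K hKN hK W hW hdiag
  refine hK.induction_on (p := fun s => ∀ᶠ m in atTop, ∀ x ∈ s, (qMap N x, f m x) ∈ W)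
    (by simp) (fun s t hst h => h.mono fun m hm x hx => hm x (hst hx))
    (fun s t hs ht => by
      filter_upwards [hs, ht] with m h1 h2 x hx
      exact hx.elim (h1 x) (h2 x)) fun x hx => ?_
  obtain ⟨v, hv, rfl⟩ := exists_lineOf_eq x
  have hNv : N *ᵥ v ≠ 0 := fun h => hKN hx ((lineOf_mem_qKer hv N).2 h)
  have h1 : Tendsto (fun q : ℕ × Vec n => lineOf (C q.1 *ᵥ q.2)) (atTop ×ˢ 𝓝 v)
      (𝓝 (lineOf (N *ᵥ v))) :=
    (continuousAt_lineOf hNv).tendsto.comp (tendsto_mulVec (hC.comp tendsto_fst) tendsto_snd)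
  have h2 : Tendsto (fun q : ℕ × Vec n => lineOf (N *ᵥ q.2)) (atTop ×ˢ 𝓝 v)
      (𝓝 (lineOf (N *ᵥ v))) :=
    (continuousAt_lineOf hNv).tendsto.comp (tendsto_mulVec tendsto_const_nhds tendsto_snd)
  have h3 : ∀ᶠ q : ℕ × Vec n in atTop ×ˢ 𝓝 v, N *ᵥ q.2 ≠ 0 :=
    (tendsto_mulVec (C := fun _ : ℕ × Vec n => N) tendsto_const_nhds tendsto_snd).eventually_ne hNv
  have h4 := (h2.prodMk_nhds h1).eventually (hW.mem_nhds (hdiag _))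
  have h5 : ∀ᶠ q : ℕ × Vec n in atTop ×ˢ 𝓝 v,
      (qMap N (lineOf q.2), f q.1 (lineOf q.2)) ∈ W := by
    filter_upwards [h3, h4] with q hq hqW
    have hq2 : q.2 ≠ 0 := fun h => hq (by rw [h, Matrix.mulVec_zero])
    rwa [qMap_lineOf hq, hf _ _ hq2]
  obtain ⟨P, hP, Q, hQ, hPQ⟩ := eventually_prod_iff.1 h5
  refine ⟨lineOf '' {u : Vec n | Q u}, mem_nhdsWithin_of_mem_nhds (nhds_lineOf_le_map hv ?_), ?_⟩
  · exact mem_map.2 (mem_of_superset hQ fun u hu => ⟨u, hu, rfl⟩)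
  · filter_upwards [hP] with m hm
    rintro _ ⟨u, hu, rfl⟩
    exact hPQ hm hu

lemma UnifConvOnCompacts.eventually_lt {n : ℕ} {f : ℕ → Pn n → Pn n} {F : Pn n → Pn n}
    {S K : Set (Pn n)} (h : UnifConvOnCompacts f F S) (hKS : K ⊆ S) (hK : IsCompact K)
    {g : Pn n → ℝ} (hg : Continuous g) {δ : ℝ} (hδ : 0 < δ) :
    ∀ᶠ m in atTop, ∀ x ∈ K, g (F x) < g (f m x) + δ :=
  h K hKS hK {p | g p.1 < g p.2 + δ} (isOpen_lt (by fun_prop) (by fun_prop)) fun y => by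
    simpa using hδ

lemma exists_continuous_lift_linear {n : ℕ} (l : Vec n →ₗ[ℂ] ℂ) :
    ∃ g : Pn n → ℝ, Continuous g ∧ ∀ v : Vec n, v ≠ 0 → g (lineOf v) = ‖l v‖ / ‖v‖ := by
  have hl := l.continuous_of_finiteDimensional
  refine exists_continuous_lift (fun v => ‖l v‖ / ‖v‖)
    (hl.norm.continuousOn.div continuous_norm.continuousOn fun v hv => norm_ne_zero_iff.2 hv)
    fun c v hc => ?_
  rw [map_smul, norm_smul, norm_smul, mul_div_mul_left _ _ (norm_ne_zero_iff.2 hc)]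

lemma exists_linear_ne_zero {n : ℕ} {a b : Vec n} (ha : a ≠ 0) (hb : b ≠ 0) :
    ∃ l : Vec n →ₗ[ℂ] ℂ, l a ≠ 0 ∧ l b ≠ 0 := by
  obtain ⟨i, hi⟩ := Function.ne_iff.1 ha
  obtain ⟨j, hj⟩ := Function.ne_iff.1 hb
  by_cases h1 : b i = 0
  · by_cases h2 : a j = 0
    · let l : Vec n →ₗ[ℂ] ℂ := LinearMap.proj (R := ℂ) (φ := fun _ => ℂ) i + LinearMap.proj j
      have hl : ∀ v, l v = v i + v j := fun v => rfl
      exact ⟨l, by simpa [hl, h2] using hi, by simpa [hl, h1] using hj⟩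
    · exact ⟨LinearMap.proj j, h2, hj⟩
  · exact ⟨LinearMap.proj i, hi, h1⟩

lemma continuous_mulVec_right {n : ℕ} (B : Mat n) : Continuous fun v : Vec n => B *ᵥ v :=
  continuous_const.matrix_mulVec continuous_id

lemma exists_mulVec_ne_zero {n : ℕ} {B : Mat n} (hB : B ≠ 0) : ∃ v, B *ᵥ v ≠ 0 := by
  by_contra! hall
  exact hB (Matrix.mulVec_injective (funext fun w => by simpa using hall w))

section Comparison

variable {n : ℕ} {f : ℕ → Pn n → Pn n} {M B : Mat n} {C : ℕ → Mat n}

lemma QPConv.mulVec_ne_zero (h : QPConv f M)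
    (hf : ∀ m v, v ≠ 0 → f m (lineOf v) = lineOf (C m *ᵥ v))
    (hinj : ∀ m v, v ≠ 0 → C m *ᵥ v ≠ 0) (hC : Tendsto C atTop (𝓝 B)) (hB : B ≠ 0)
    {x : Vec n} (hx : M *ᵥ x ≠ 0) : B *ᵥ x ≠ 0 := by
  intro hBx
  obtain ⟨w, hw⟩ := exists_mulVec_ne_zero hB
  obtain ⟨l, hlx, hlw⟩ := exists_linear_ne_zero hx hw
  have hl := l.continuous_of_finiteDimensional
  obtain ⟨g, hg, hgl⟩ := exists_continuous_lift_linear l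
  set a := ‖l (M *ᵥ x)‖ / ‖M *ᵥ x‖ with ha_def
  have ha : 0 < a := div_pos (norm_pos_iff.2 hlx) (norm_pos_iff.2 hx)
  have hline : Continuous fun s : ℂ => x + s • w := by fun_prop
  have hMline : Continuous fun s : ℂ => M *ᵥ (x + s • w) := (continuous_mulVec_right M).comp hline
  have hne : ∀ᶠ s : ℂ in 𝓝 0, M *ᵥ (x + s • w) ≠ 0 :=
    hMline.continuousAt.eventually_ne (by simpa using hx)
  have hbig : ∀ᶠ s : ℂ in 𝓝 0, a / 2 < ‖l (M *ᵥ (x + s • w))‖ / ‖M *ᵥ (x + s • w)‖ := by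
    have hcont : ContinuousAt (fun s : ℂ => ‖l (M *ᵥ (x + s • w))‖ / ‖M *ᵥ (x + s • w)‖) 0 :=
      (hl.comp hMline).norm.continuousAt.div hMline.norm.continuousAt (by simpa using hx)
    refine hcont.tendsto.eventually (lt_mem_nhds ?_)
    simpa [← ha_def] using half_lt_self ha
  obtain ⟨r, hr, hball⟩ := Metric.nhds_basis_closedBall.mem_iff.1 (hne.and hbig)
  have hline_ne : ∀ s ∈ Metric.closedBall (0 : ℂ) r, x + s • w ≠ 0 := fun s hs h0 =>
    (hball hs).1 (by rw [h0, Matrix.mulVec_zero])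
  have hK : IsCompact ((fun s : ℂ => lineOf (x + s • w)) '' Metric.closedBall 0 r) :=
    (isCompact_closedBall _ _).image_of_continuousOn fun s hs =>
      (ContinuousAt.comp (f := fun s : ℂ => x + s • w) (continuousAt_lineOf (hline_ne s hs))
        hline.continuousAt).continuousWithinAt
  have hKM : (fun s : ℂ => lineOf (x + s • w)) '' Metric.closedBall 0 r ⊆ (qKer M)ᶜ := by
    rintro _ ⟨s, hs, rfl⟩ hmem
    exact (hball hs).1 ((lineOf_mem_qKer (hline_ne s hs) M).1 hmem)
  have hunif := h.eventually_lt hKM hK hg (half_pos ha)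
  have hlC : ∀ v, Tendsto (fun m => l (C m *ᵥ v)) atTop (𝓝 (l (B *ᵥ v))) := fun v =>
    (hl.tendsto _).comp (tendsto_mulVec hC tendsto_const_nhds)
  have hs : Tendsto (fun m => -(l (C m *ᵥ x) / l (C m *ᵥ w))) atTop (𝓝 0) := by
    simpa [hBx] using ((hlC x).div (hlC w) hlw).neg
  obtain ⟨m, hm1, hm2, hm3⟩ := (hunif.and ((hs.eventually (Metric.closedBall_mem_nhds 0 hr)).and
    ((hlC w).eventually_ne hlw))).exists
  have h1 := hm1 _ ⟨_, hm2, rfl⟩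
  have h2 := hball hm2
  have h3 := hline_ne _ hm2
  rw [qMap_lineOf h2.1, hgl _ h2.1, hf _ _ h3, hgl _ (hinj _ _ h3)] at h1
  have h4 : l (C m *ᵥ (x + -(l (C m *ᵥ x) / l (C m *ᵥ w)) • w)) = 0 := by
    rw [Matrix.mulVec_add, Matrix.mulVec_smul, map_add, map_smul, smul_eq_mul, neg_mul,
      div_mul_cancel₀ _ hm3, add_neg_cancel]
  rw [h4, norm_zero, zero_div, zero_add] at h1
  exact lt_asymm h1 h2.2

lemma QPConv.mulVec_mem_span (h : QPConv f M)
    (hf : ∀ m v, v ≠ 0 → f m (lineOf v) = lineOf (C m *ᵥ v))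
    (hinj : ∀ m v, v ≠ 0 → C m *ᵥ v ≠ 0) (hC : Tendsto C atTop (𝓝 B)) (hB : B ≠ 0)
    (x : Vec n) : M *ᵥ x ∈ Submodule.span ℂ {B *ᵥ x} := by
  by_contra hmem
  have hMx : M *ᵥ x ≠ 0 := fun h0 => hmem (h0 ▸ zero_mem _)
  have hx : x ≠ 0 := by rintro rfl; simp at hMx
  have hBx := h.mulVec_ne_zero hf hinj hC hB hMx
  obtain ⟨l, hl1, hl2⟩ := Submodule.exists_le_ker_of_notMem hmem
  have hlB : l (B *ᵥ x) = 0 := hl2 (Submodule.mem_span_singleton_self _)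
  have hl := l.continuous_of_finiteDimensional
  obtain ⟨g, hg, hgl⟩ := exists_continuous_lift_linear l
  have hpos : 0 < ‖l (M *ᵥ x)‖ / ‖M *ᵥ x‖ := div_pos (norm_pos_iff.2 hl1) (norm_pos_iff.2 hMx)
  have hKM : {lineOf x} ⊆ (qKer M)ᶜ :=
    Set.singleton_subset_iff.2 fun hmem => hMx ((lineOf_mem_qKer hx M).1 hmem)
  have hunif := h.eventually_lt hKM isCompact_singleton hg (half_pos hpos)
  have hlim : Tendsto (fun m => ‖l (C m *ᵥ x)‖ / ‖C m *ᵥ x‖) atTop (𝓝 0) := by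
    have hCx := tendsto_mulVec hC (tendsto_const_nhds (x := x))
    simpa [hlB, Pi.div_def] using (((hl.tendsto _).comp hCx).norm).div hCx.norm (norm_ne_zero_iff.2 hBx)
  obtain ⟨m, hm1, hm2⟩ := (hunif.and (hlim.eventually (gt_mem_nhds (half_pos hpos)))).exists
  have h1 := hm1 _ rfl
  rw [qMap_lineOf hMx, hgl _ hMx, hf _ _ hx, hgl _ (hinj _ _ hx)] at h1
  linarith

end Comparison

/-- The Gram matrix of the Hermitian form `herm n`. -/
def signature (n : ℕ) : Mat n := Matrix.diagonal (Fin.cons (-1) fun _ => 1)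

/-- The adjoint of a matrix with respect to the Hermitian form `herm n`. -/
def hermAdj {n : ℕ} (A : Mat n) : Mat n := signature n * Aᴴ * signature n

lemma signature_mul_self (n : ℕ) : signature n * signature n = 1 := by
  rw [signature, Matrix.diagonal_mul_diagonal, ← Matrix.diagonal_one]
  congr 1
  funext i
  refine Fin.cases ?_ (fun j => ?_) i <;> simp

lemma signature_conjTranspose (n : ℕ) : (signature n)ᴴ = signature n := by
  rw [signature, Matrix.diagonal_conjTranspose]
  congr 1
  funext i
  refine Fin.cases ?_ (fun j => ?_) i <;> simp

lemma herm_eq_dotProduct {n : ℕ} (u v : Vec n) :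
    herm n u v = star v ⬝ᵥ (signature n *ᵥ u) := by
  simp only [herm, dotProduct, signature, Matrix.mulVec_diagonal, Fin.sum_univ_succ]
  simp [mul_comm]

lemma herm_star {n : ℕ} (u v : Vec n) : (starRingEnd ℂ) (herm n u v) = herm n v u := by
  simp [herm, mul_comm]

lemma herm_smul_left {n : ℕ} (c : ℂ) (u v : Vec n) : herm n (c • u) v = c * herm n u v := by
  rw [herm_eq_dotProduct, herm_eq_dotProduct, Matrix.mulVec_smul, dotProduct_smul, smul_eq_mul]

lemma herm_sub_left {n : ℕ} (u u' v : Vec n) :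
    herm n (u - u') v = herm n u v - herm n u' v := by
  simp only [herm_eq_dotProduct, Matrix.mulVec_sub, dotProduct_sub]

lemma herm_smul_right {n : ℕ} (c : ℂ) (u v : Vec n) :
    herm n u (c • v) = (starRingEnd ℂ) c * herm n u v := by
  rw [← herm_star, herm_smul_left, map_mul, herm_star]

lemma herm_sub_right {n : ℕ} (u v v' : Vec n) :
    herm n u (v - v') = herm n u v - herm n u v' := by
  rw [← herm_star, herm_sub_left, map_sub, herm_star, herm_star]

lemma herm_mulVec_left {n : ℕ} (A : Mat n) (u v : Vec n) :
    herm n (A *ᵥ u) v = herm n u (hermAdj A *ᵥ v) := by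
  have h : (hermAdj A)ᴴ * signature n = signature n * A := by
    simp only [hermAdj, Matrix.conjTranspose_mul, signature_conjTranspose,
      Matrix.conjTranspose_conjTranspose, Matrix.mul_assoc, signature_mul_self, Matrix.mul_one]
  rw [herm_eq_dotProduct, herm_eq_dotProduct, Matrix.star_mulVec, ← Matrix.dotProduct_mulVec,
    Matrix.mulVec_mulVec, Matrix.mulVec_mulVec, h]

lemma hermAdj_hermAdj {n : ℕ} (A : Mat n) : hermAdj (hermAdj A) = A := by
  simp only [hermAdj, Matrix.conjTranspose_mul, signature_conjTranspose,
    Matrix.conjTranspose_conjTranspose, Matrix.mul_assoc, signature_mul_self, Matrix.mul_one]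
  rw [← Matrix.mul_assoc, signature_mul_self, Matrix.one_mul]

lemma hermAdj_real_smul {n : ℕ} (c : ℝ) (A : Mat n) : hermAdj (c • A) = c • hermAdj A := by
  simp [hermAdj, Matrix.conjTranspose_smul]

lemma continuous_hermAdj (n : ℕ) : Continuous (hermAdj : Mat n → Mat n) := by
  have h1 : Continuous fun A : Mat n => Aᴴ := continuous_id.matrix_conjTranspose
  have h2 : Continuous fun A : Mat n => signature n * A := continuous_const.matrix_mul continuous_id
  have h3 : Continuous fun A : Mat n => A * signature n := continuous_id.matrix_mul continuous_const
  exact h3.comp (h2.comp h1)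

open scoped ComplexOrder in
lemma eq_zero_of_herm_left {n : ℕ} {u : Vec n} (h : ∀ v, herm n u v = 0) : u = 0 := by
  have h0 : signature n *ᵥ u = 0 := by
    have := h (signature n *ᵥ u)
    rwa [herm_eq_dotProduct, dotProduct_star_self_eq_zero] at this
  rw [← Matrix.one_mulVec u, ← signature_mul_self, ← Matrix.mulVec_mulVec, h0, Matrix.mulVec_zero]

lemma hermAdj_mul_self_of_mem_unitaryGL {n : ℕ} {A : GLn n} (hA : A ∈ unitaryGL n) :
    hermAdj (A : Mat n) * (A : Mat n) = 1 := by
  refine Matrix.mulVec_injective (funext fun v => sub_eq_zero.1 (eq_zero_of_herm_left fun w => ?_))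
  rw [herm_sub_left, ← Matrix.mulVec_mulVec, herm_mulVec_left, hermAdj_hermAdj, hA v w,
    Matrix.one_mulVec, sub_self]

lemma coe_inv_of_mem_unitaryGL {n : ℕ} {A : GLn n} (hA : A ∈ unitaryGL n) :
    ((A⁻¹ : GLn n) : Mat n) = hermAdj (A : Mat n) := by
  rw [← mul_one (hermAdj _), ← Units.mul_inv A, ← mul_assoc, hermAdj_mul_self_of_mem_unitaryGL hA,
    one_mul]

lemma herm_self_of_zero_coord {n : ℕ} {v : Vec n} (h0 : v 0 = 0) :
    herm n v v = ((∑ j : Fin n, ‖v j.succ‖ ^ 2 : ℝ) : ℂ) := by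
  simp [herm, h0, Complex.mul_conj']

lemma eq_zero_of_herm_self_nonpos {n : ℕ} {v : Vec n} (h0 : v 0 = 0)
    (h : (herm n v v).re ≤ 0) : v = 0 := by
  rw [herm_self_of_zero_coord h0, Complex.ofReal_re] at h
  have hz := (Finset.sum_eq_zero_iff_of_nonneg fun j _ => sq_nonneg ‖v j.succ‖).1
    (le_antisymm h (Finset.sum_nonneg fun j _ => sq_nonneg _))
  funext i
  refine Fin.cases h0 (fun j => ?_) i
  simpa using hz j (Finset.mem_univ j)

lemma coord_zero_ne_zero {n : ℕ} {w : Vec n} (hw : w ≠ 0) (hww : herm n w w = 0) : w 0 ≠ 0 :=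
  fun h0 => hw (eq_zero_of_herm_self_nonpos h0 (by simp [hww]))

lemma exists_eq_smul_of_herm_eq_zero {n : ℕ} {v w : Vec n} (hw : w ≠ 0) (hww : herm n w w = 0)
    (hvw : herm n v w = 0) (hvv : (herm n v v).re ≤ 0) : ∃ c : ℂ, c • w = v := by
  have hw0 := coord_zero_ne_zero hw hww
  have hwv : herm n w v = 0 := by rw [← herm_star, hvw, map_zero]
  refine ⟨v 0 / w 0, (sub_eq_zero.1 (eq_zero_of_herm_self_nonpos ?_ ?_)).symm⟩
  · simp [hw0]
  · simpa [herm_sub_left, herm_sub_right, herm_smul_left, herm_smul_right, hww, hvw, hwv] using hvv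

/-- A nonzero matrix with totally isotropic range has rank one; its range is spanned by a null
vector, whose orthogonal complement is the kernel of the adjoint. -/
lemma exists_null_vector {n : ℕ} {B : Mat n} (hB : B ≠ 0) (h : hermAdj B * B = 0) :
    ∃ p : Vec n, p ≠ 0 ∧ herm n p p = 0 ∧
      LinearMap.range B.mulVecLin = Submodule.span ℂ {p} ∧
      ∀ v, hermAdj B *ᵥ v = 0 ↔ herm n v p = 0 := by
  have hiso : ∀ u v, herm n (B *ᵥ u) (B *ᵥ v) = 0 := fun u v => by
    rw [herm_mulVec_left, Matrix.mulVec_mulVec, h, Matrix.zero_mulVec, herm_eq_dotProduct,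
      star_zero, zero_dotProduct]
  obtain ⟨w, hw⟩ := exists_mulVec_ne_zero hB
  have hspan : ∀ u, ∃ c : ℂ, c • (B *ᵥ w) = B *ᵥ u := fun u =>
    exists_eq_smul_of_herm_eq_zero hw (hiso w w) (hiso u w) (by simp [hiso])
  refine ⟨B *ᵥ w, hw, hiso w w, ?_, fun v => ?_⟩
  · refine le_antisymm ?_ ((Submodule.span_singleton_le_iff_mem _ _).2 ⟨w, rfl⟩)
    rintro _ ⟨u, rfl⟩
    exact Submodule.mem_span_singleton.2 (hspan u)
  · have hadj : ∀ u, herm n (hermAdj B *ᵥ v) u = herm n v (B *ᵥ u) := fun u => by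
      rw [herm_mulVec_left, hermAdj_hermAdj]
    refine ⟨fun hv => ?_, fun hv => eq_zero_of_herm_left fun u => ?_⟩
    · rw [← hadj, hv, ← zero_smul ℂ (0 : Vec n), herm_smul_left, zero_mul]
    · obtain ⟨c, hc⟩ := hspan u
      rw [hadj, ← hc, herm_smul_right, hv, mul_zero]

lemma qIm_eq_singleton {n : ℕ} {N : Mat n} {p : Vec n} (hp : p ≠ 0)
    (h : LinearMap.range N.mulVecLin = Submodule.span ℂ {p}) : qIm N = {lineOf p} := by
  ext x
  obtain ⟨v, hv, rfl⟩ := exists_lineOf_eq x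
  rw [qIm, lineOf_mem_projSet hv, h, Submodule.mem_span_singleton, Set.mem_singleton_iff,
    lineOf_eq_iff hv hp]

lemma exists_continuous_lift_herm (n : ℕ) :
    ∃ g : Pn n → ℝ, Continuous g ∧
      ∀ v : Vec n, v ≠ 0 → g (lineOf v) = (herm n v v).re / ‖v‖ ^ 2 := by
  have hc : Continuous fun v : Vec n => (herm n v v).re := by
    unfold herm
    fun_prop
  refine exists_continuous_lift (fun v => (herm n v v).re / ‖v‖ ^ 2)
    (hc.continuousOn.div (by fun_prop) fun v hv => pow_ne_zero 2 (norm_ne_zero_iff.2 hv))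
    fun c v hc => ?_
  have h : (herm n (c • v) (c • v)).re = ‖c‖ ^ 2 * (herm n v v).re := by
    rw [herm_smul_left, herm_smul_right, ← mul_assoc, Complex.mul_conj', ← Complex.ofReal_pow,
      Complex.re_ofReal_mul]
  rw [h, norm_smul, mul_pow, mul_div_mul_left _ _ (pow_ne_zero 2 (norm_ne_zero_iff.2 hc))]

lemma herm_nonpos_of_mem_closure {n : ℕ} {v : Vec n} (hv : v ≠ 0)
    (h : lineOf v ∈ closure (Hball n)) : (herm n v v).re ≤ 0 := by
  obtain ⟨g, hg, hgv⟩ := exists_continuous_lift_herm n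
  have hsub : Hball n ⊆ {x | g x ≤ 0} := by
    rintro _ ⟨u, hu, rfl, hneg⟩
    change g _ ≤ 0
    rw [← lineOf_of_ne hu, hgv u hu]
    exact div_nonpos_of_nonpos_of_nonneg hneg.le (sq_nonneg _)
  have h1 : g (lineOf v) ≤ 0 := closure_minimal hsub (isClosed_le hg continuous_const) h
  rw [hgv v hv] at h1
  by_contra! hpos
  exact absurd h1 (not_le.2 (div_pos hpos (pow_pos (norm_pos_iff.2 hv) 2)))

lemma lineOf_mem_closure_Hball {n : ℕ} {w : Vec n} (hw : w ≠ 0) (hww : herm n w w = 0) :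
    lineOf w ∈ closure (Hball n) := by
  have hw0 := coord_zero_ne_zero hw hww
  let u : ℝ → Vec n := fun t => Function.update w 0 ((1 + t : ℝ) * w 0)
  have hu : Continuous u := continuous_const.update 0 (by fun_prop)
  have hu0 : u 0 = w := by simp [u]
  have hlim : Tendsto (fun t => lineOf (u t)) (𝓝[>] 0) (𝓝 (lineOf w)) := by
    refine (continuousAt_lineOf hw).tendsto.comp ?_
    have := hu.tendsto 0
    rw [hu0] at this
    exact this.mono_left nhdsWithin_le_nhds
  refine mem_closure_of_tendsto hlim (eventually_mem_nhdsWithin.mono fun t ht => ?_)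
  have ht : 0 < t := ht
  have hut : u t ≠ 0 := fun h => by
    have h1 := congrFun h 0
    simp only [u, Function.update_self, Pi.zero_apply, mul_eq_zero, hw0, or_false,
      Complex.ofReal_eq_zero] at h1
    linarith
  refine ⟨u t, hut, lineOf_of_ne hut, ?_⟩
  have h1 : herm n (u t) (u t) = herm n w w + ((-(2 * t + t ^ 2) * ‖w 0‖ ^ 2 : ℝ) : ℂ) := by
    simp only [herm, u, Function.update_self, Function.update_of_ne (Fin.succ_ne_zero _), map_mul,
      Complex.conj_ofReal]
    have := Complex.mul_conj' (w 0)
    push_cast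
    linear_combination (-(2 * (t : ℂ) + t ^ 2)) * this
  rw [h1, hww, zero_add, Complex.ofReal_re]
  have := pow_pos (norm_pos_iff.2 hw0) 2
  nlinarith [mul_pos ht this]

section OrthogonalHyperplane

variable {n : ℕ} {N : Mat n} {p : Vec n}

lemma qKer_inter_closure_Hball (hp : p ≠ 0) (hpp : herm n p p = 0)
    (h : ∀ v, N *ᵥ v = 0 ↔ herm n v p = 0) : qKer N ∩ closure (Hball n) = {lineOf p} := by
  ext x
  obtain ⟨v, hv, rfl⟩ := exists_lineOf_eq x
  rw [Set.mem_inter_iff, lineOf_mem_qKer hv, h, Set.mem_singleton_iff]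
  refine ⟨fun hx => (lineOf_eq_iff hv hp).2 ?_, fun hx => ?_⟩
  · exact exists_eq_smul_of_herm_eq_zero hp hpp hx.1 (herm_nonpos_of_mem_closure hv hx.2)
  · obtain ⟨c, rfl⟩ := (lineOf_eq_iff hv hp).1 hx
    exact ⟨by rw [herm_smul_left, hpp, mul_zero], hx ▸ lineOf_mem_closure_Hball hp hpp⟩

lemma qKer_inter_Hbdry (hp : p ≠ 0) (hpp : herm n p p = 0)
    (h : ∀ v, N *ᵥ v = 0 ↔ herm n v p = 0) : qKer N ∩ Hbdry n = {lineOf p} := by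
  refine subset_antisymm ?_ ?_
  · rw [← qKer_inter_closure_Hball hp hpp h]
    rintro _ ⟨hx, v, hv, rfl, hvv⟩
    exact ⟨hx, lineOf_of_ne hv ▸ lineOf_mem_closure_Hball hv hvv⟩
  · rw [Set.singleton_subset_iff]
    exact ⟨(lineOf_mem_qKer hp N).2 ((h p).2 hpp), mem_Hbdry_lineOf hp hpp⟩

end OrthogonalHyperplane

lemma isProjHyperplane_qKer {n : ℕ} {N : Mat n} {p : Vec n} (hp : p ≠ 0)
    (h : LinearMap.range N.mulVecLin = Submodule.span ℂ {p}) : IsProjHyperplane (qKer N) := by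
  refine ⟨_, ?_, rfl⟩
  have hrank := LinearMap.finrank_range_add_finrank_ker N.mulVecLin
  rw [h, finrank_span_singleton hp, Module.finrank_fin_fun] at hrank
  exact Nat.add_left_cancel (hrank.trans (add_comm n 1))

lemma exists_subseq_tendsto_or_normalized {E : Type*} [NormedAddCommGroup E] [NormedSpace ℝ E]
    [ProperSpace E] (a : ℕ → E) :
    (∃ φ : ℕ → ℕ, StrictMono φ ∧ ∃ l, Tendsto (a ∘ φ) atTop (𝓝 l)) ∨
      ∃ φ : ℕ → ℕ, StrictMono φ ∧ ∃ c : ℕ → ℝ, (∀ k, c k ≠ 0) ∧ Tendsto c atTop (𝓝 0) ∧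
        ∃ b ≠ 0, Tendsto (fun k => c k • a (φ k)) atTop (𝓝 b) := by
  by_cases h : Tendsto (fun m => ‖a m‖) atTop atTop
  · right
    set c : ℕ → ℝ := fun m => (‖a m‖ + 1)⁻¹ with hc_def
    have hpos : ∀ m, 0 < ‖a m‖ + 1 := fun m => by positivity
    have hc : Tendsto c atTop (𝓝 0) :=
      tendsto_inv_atTop_zero.comp (tendsto_atTop_add_const_right _ 1 h)
    have hnorm : ∀ m, ‖c m • a m‖ = 1 - c m := fun m => by
      rw [norm_smul, Real.norm_of_nonneg (inv_nonneg.2 (hpos m).le), hc_def]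
      field_simp [(hpos m).ne']
      ring
    obtain ⟨b, -, φ, hφ, hb⟩ := tendsto_subseq_of_bounded (Metric.isBounded_closedBall (x := 0)
      (r := 1)) (x := fun m => c m • a m) fun m => by
        rw [mem_closedBall_zero_iff, hnorm]
        exact sub_le_self _ (inv_nonneg.2 (hpos m).le)
    have hcφ := hc.comp hφ.tendsto_atTop
    refine ⟨φ, hφ, c ∘ φ, fun k => inv_ne_zero (hpos _).ne', hcφ, b, ?_, hb⟩
    have h1 : Tendsto (fun k => 1 - c (φ k)) atTop (𝓝 ‖b‖) :=
      hb.norm.congr fun k => hnorm (φ k)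
    have h2 : ‖b‖ = 1 := by
      simpa using tendsto_nhds_unique h1 (tendsto_const_nhds.sub hcφ)
    rintro rfl
    simp at h2
  · left
    simp only [tendsto_atTop, not_forall] at h
    obtain ⟨R, hR⟩ := h
    have hfreq : ∃ᶠ m in atTop, a m ∈ Metric.closedBall (0 : E) R :=
      (not_eventually.1 hR).mono fun m hm => mem_closedBall_zero_iff.2 (not_le.1 hm).le
    obtain ⟨l, -, φ, hφ, hl⟩ := tendsto_subseq_of_frequently_bounded Metric.isBounded_closedBall hfreq
    exact ⟨φ, hφ, l, hl⟩

lemma not_tendsto_of_injective_of_discrete {Γ : Type*} [Group Γ] [TopologicalSpace Γ]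
    [IsTopologicalGroup Γ] (G : Subgroup Γ) [DiscreteTopology G] {γ : ℕ → G}
    (hγ : Function.Injective γ) (g : Γ) : ¬Tendsto (fun m => (γ m : Γ)) atTop (𝓝 g) := by
  intro h
  have h1 : Tendsto (fun m => (((γ m)⁻¹ * γ (m + 1) : G) : Γ)) atTop (𝓝 ((1 : G) : Γ)) := by
    simpa using h.inv.mul (h.comp (tendsto_add_atTop_nat 1))
  have h2 : Tendsto (fun m => (γ m)⁻¹ * γ (m + 1)) atTop (𝓝 (1 : G)) :=
    tendsto_subtype_rng.2 h1
  rw [nhds_discrete, tendsto_pure] at h2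
  obtain ⟨m, hm⟩ := h2.exists
  exact Nat.succ_ne_self m (hγ (inv_mul_eq_one.1 hm)).symm

lemma exists_tendsto_of_mem_unitaryGL {n : ℕ} {A : ℕ → GLn n} (hA : ∀ m, A m ∈ unitaryGL n)
    {B : Mat n} (h : Tendsto (fun m => (A m : Mat n)) atTop (𝓝 B)) :
    ∃ g : GLn n, Tendsto A atTop (𝓝 g) := by
  have hadj : Tendsto (fun m => hermAdj (A m : Mat n)) atTop (𝓝 (hermAdj B)) :=
    ((continuous_hermAdj n).tendsto B).comp h
  have hmul : hermAdj B * B = 1 :=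
    tendsto_nhds_unique (hadj.mul h)
      (tendsto_const_nhds.congr fun m => (hermAdj_mul_self_of_mem_unitaryGL (hA m)).symm)
  refine ⟨⟨B, hermAdj B, mul_eq_one_comm.1 hmul, hmul⟩, ?_⟩
  rw [Units.isInducing_embedProduct.tendsto_nhds_iff]
  refine h.prodMk_nhds ((MulOpposite.continuous_op.tendsto _).comp ?_)
  exact hadj.congr fun m => (coe_inv_of_mem_unitaryGL (hA m)).symm

lemma exists_normalized_limit {n : ℕ} (G : Subgroup (PGLn n)) (hdisc : DiscreteTopology ↥G)
    {γ : ℕ → G} (hγ : Function.Injective γ) {A : ℕ → GLn n} (hA : ∀ m, A m ∈ unitaryGL n)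
    (hAγ : ∀ m, QuotientGroup.mk (A m) = (γ m : PGLn n)) :
    ∃ φ : ℕ → ℕ, StrictMono φ ∧ ∃ c : ℕ → ℝ, (∀ k, c k ≠ 0) ∧ Tendsto c atTop (𝓝 0) ∧
      ∃ B : Mat n, B ≠ 0 ∧ Tendsto (fun k => c k • (A (φ k) : Mat n)) atTop (𝓝 B) := by
  refine (exists_subseq_tendsto_or_normalized (E := Fin (n + 1) → Fin (n + 1) → ℂ)
    fun m => (A m : Mat n)).resolve_left ?_
  rintro ⟨φ, hφ, l, hl⟩
  obtain ⟨g, hg⟩ := exists_tendsto_of_mem_unitaryGL (fun k => hA (φ k)) (B := l) hl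
  refine not_tendsto_of_injective_of_discrete G (hγ.comp hφ.injective) (QuotientGroup.mk g) ?_
  refine ((QuotientGroup.continuous_mk.tendsto g).comp hg).congr fun k => ?_
  exact hAγ (φ k)

lemma QPConv.comp {n : ℕ} {f : ℕ → Pn n → Pn n} {M : Mat n} (h : QPConv f M) {φ : ℕ → ℕ}
    (hφ : StrictMono φ) : QPConv (fun k => f (φ k)) M := fun K hKM hK W hW hdiag =>
  hφ.tendsto_atTop.eventually (h K hKM hK W hW hdiag)

lemma lineOf_real_smul_mulVec {n : ℕ} {c : ℝ} (hc : c ≠ 0) (A : Mat n) (v : Vec n) :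
    lineOf ((c • A) *ᵥ v) = lineOf (A *ᵥ v) := by
  have h : (c • A) *ᵥ v = (c : ℂ) • (A *ᵥ v) := by
    rw [Matrix.smul_mulVec, ← Complex.coe_smul]
  rw [h, lineOf_smul (Complex.ofReal_ne_zero.2 hc)]

lemma range_eq_span_of_mulVec_mem_span {n : ℕ} {M B : Mat n} {p : Vec n} (hM : M ≠ 0)
    (hB : LinearMap.range B.mulVecLin = Submodule.span ℂ {p})
    (h : ∀ x, M *ᵥ x ∈ Submodule.span ℂ {B *ᵥ x}) :
    LinearMap.range M.mulVecLin = Submodule.span ℂ {p} := by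
  have hle : LinearMap.range M.mulVecLin ≤ Submodule.span ℂ {p} := by
    rintro _ ⟨x, rfl⟩
    refine (Submodule.span_singleton_le_iff_mem _ _).2 ?_ (h x)
    exact hB ▸ ⟨x, rfl⟩
  refine le_antisymm hle ((Submodule.span_singleton_le_iff_mem _ _).2 ?_)
  obtain ⟨w, hw⟩ := exists_mulVec_ne_zero hM
  obtain ⟨c, hc⟩ := Submodule.mem_span_singleton.1 (hle ⟨w, rfl⟩)
  have hc0 : c ≠ 0 := by
    rintro rfl
    exact hw (by simpa using hc.symm)
  refine ((LinearMap.range M.mulVecLin).smul_mem_iff hc0).1 ?_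
  rw [hc]
  exact ⟨w, rfl⟩

lemma ker_eq_of_le_of_range_eq_span {n : ℕ} {M B : Mat n} {p : Vec n}
    (hM : LinearMap.range M.mulVecLin = Submodule.span ℂ {p})
    (hB : LinearMap.range B.mulVecLin = Submodule.span ℂ {p})
    (h : LinearMap.ker B.mulVecLin ≤ LinearMap.ker M.mulVecLin) :
    LinearMap.ker B.mulVecLin = LinearMap.ker M.mulVecLin := by
  refine Submodule.eq_of_le_of_finrank_eq h ?_
  have h1 := LinearMap.finrank_range_add_finrank_ker M.mulVecLin
  have h2 := LinearMap.finrank_range_add_finrank_ker B.mulVecLin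
  rw [hM] at h1
  rw [hB] at h2
  exact Nat.add_left_cancel (h2.trans h1.symm)

end

/-- If a sequence `(γ_m)` of pairwise distinct elements of a discrete
subgroup `G` of `PU(1,n)` converges as quasi-projective transformations to `γ`, then
after passing to a subsequence, `(γ_m⁻¹)` converges as quasi-projective transformations
to a quasi-projective map `τ` with: `Im(τ)` a single point of `∂𝐇ⁿ_ℂ`; `Ker(τ)` a
hyperplane meeting the closure of `𝐇ⁿ_ℂ` in exactly one boundary point;
`Im(τ) = Ker(γ) ∩ ∂𝐇ⁿ_ℂ` and `Im(γ) = Ker(τ) ∩ ∂𝐇ⁿ_ℂ`. -/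
theorem qp_limit_of_inverses
    (n : ℕ) (hn : 1 ≤ n) (G : Subgroup (PGLn n))
    (hPU : (G : Set (PGLn n)) ⊆ PUset n) (hdisc : DiscreteTopology ↥G)
    (γ : ℕ → G) (hγ : Function.Injective γ) (M : Mat n) (hM : M ≠ 0)
    (hconv : QPConv (fun m => act (γ m : PGLn n)) M) :
    ∃ φ : ℕ → ℕ, StrictMono φ ∧ ∃ N : Mat n, N ≠ 0 ∧
      QPConv (fun k => act (((γ (φ k))⁻¹ : G) : PGLn n)) N ∧
      (∃ q ∈ Hbdry n, qIm N = {q}) ∧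
      (IsProjHyperplane (qKer N) ∧ ∃ q ∈ Hbdry n, qKer N ∩ closure (Hball n) = {q}) ∧
      qIm N = qKer M ∩ Hbdry n ∧
      qIm M = qKer N ∩ Hbdry n := by
  have hrep : ∀ m, ∃ A : GLn n, A ∈ unitaryGL n ∧ QuotientGroup.mk A = (γ m : PGLn n) :=
    fun m => hPU (γ m).2
  choose A hA hAγ using hrep
  obtain ⟨φ, hφ, c, hc, hc0, B, hB, hlim⟩ := exists_normalized_limit G hdisc hγ hA hAγ
  have hadj : Tendsto (fun k => c k • hermAdj (A (φ k) : Mat n)) atTop (𝓝 (hermAdj B)) :=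
    (((continuous_hermAdj n).tendsto B).comp hlim).congr fun k => hermAdj_real_smul _ _
  have hcc : Tendsto (fun k => (c k * c k) • (1 : Mat n)) atTop (𝓝 0) := by
    simpa using (hc0.mul hc0).smul_const (1 : Mat n)
  have hNB : hermAdj B * B = 0 := by
    refine tendsto_nhds_unique (hadj.mul hlim) (hcc.congr fun k => ?_)
    rw [smul_mul_smul_comm, hermAdj_mul_self_of_mem_unitaryGL (hA _)]
  have hBN : B * hermAdj B = 0 := by
    refine tendsto_nhds_unique (hlim.mul hadj) (hcc.congr fun k => ?_)
    rw [smul_mul_smul_comm, mul_eq_one_comm.1 (hermAdj_mul_self_of_mem_unitaryGL (hA _))]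
  have hN : hermAdj B ≠ 0 := fun h => hB (by
    rw [← hermAdj_hermAdj B, h, hermAdj, Matrix.conjTranspose_zero, mul_zero, zero_mul])
  obtain ⟨p, hp, hpp, hBrange, hNker⟩ := exists_null_vector hB hNB
  obtain ⟨q, hq, hqq, hNrange, hBker⟩ :=
    exists_null_vector hN (by rw [hermAdj_hermAdj, hBN])
  rw [hermAdj_hermAdj] at hBker
  have hact : ∀ k v, v ≠ 0 →
      act (γ (φ k) : PGLn n) (lineOf v) = lineOf ((c k • (A (φ k) : Mat n)) *ᵥ v) := fun k v hv => by
    rw [← hAγ, act_mk_lineOf _ hv, lineOf_real_smul_mulVec (hc k)]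
  have hactinv : ∀ k v, v ≠ 0 → act (((γ (φ k))⁻¹ : G) : PGLn n) (lineOf v) =
      lineOf ((c k • hermAdj (A (φ k) : Mat n)) *ᵥ v) := fun k v hv => by
    rw [Subgroup.coe_inv, ← hAγ, ← QuotientGroup.mk_inv, act_mk_lineOf _ hv,
      lineOf_real_smul_mulVec (hc k), coe_inv_of_mem_unitaryGL (hA _)]
  have hinj : ∀ k v, v ≠ 0 → (c k • (A (φ k) : Mat n)) *ᵥ v ≠ 0 := fun k v hv => by
    rw [Matrix.smul_mulVec]
    refine smul_ne_zero (hc k) fun h => hv (glInj (A (φ k)) ?_)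
    simpa using h
  have hconv' := hconv.comp hφ
  have hMrange := range_eq_span_of_mulVec_mem_span hM hBrange
    (hconv'.mulVec_mem_span hact hinj hlim hB)
  have hMB := ker_eq_of_le_of_range_eq_span hMrange hBrange fun x hx => by
    by_contra hMx
    exact hconv'.mulVec_ne_zero hact hinj hlim hB hMx hx
  have hMker : ∀ v, M *ᵥ v = 0 ↔ herm n v q = 0 := fun v =>
    (SetLike.ext_iff.1 hMB v).symm.trans (hBker v)
  refine ⟨φ, hφ, hermAdj B, hN, qpConv_of_tendsto hactinv hadj,
    ⟨lineOf q, mem_Hbdry_lineOf hq hqq, qIm_eq_singleton hq hNrange⟩,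
    ⟨isProjHyperplane_qKer hq hNrange, lineOf p, mem_Hbdry_lineOf hp hpp,
      qKer_inter_closure_Hball hp hpp hNker⟩, ?_, ?_⟩
  · rw [qIm_eq_singleton hq hNrange, qKer_inter_Hbdry hq hqq hMker]
  · rw [qIm_eq_singleton hp hMrange, qKer_inter_Hbdry hp hpp hNker]
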